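/- arXiv:1405.0113 — 2 statements merged into one kernel-verified Lean document; each statement's English description precedes it below -/
import Mathlib

section
/- Let n ≥ 1 and d be integers with |d| ≥ 2, with d-sequence n = n_0 > n_1 > ⋯ > n_k = n_{k+1} and m = n_k. Let Σ_0(n,d) and S_0(n,d) denote the kernels of the endomorphism g ↦ d^k·g on Σ(n,d) and on S(n,d), respectively. Then Σ(n,d) ≅ Σ_0(n,d) ⊕ Σ(m,d) and S(n,d) ≅ S_0(n,d) ⊕ S(m,d), where Σ(m,d) and S(m,d) are defined in the same way with m in place of n. -/
open Finset

noncomputable section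

/-- The ring `ℤ[x]/(x^n - 1)`, realized as the group algebra `ℤ[ℤ/n]`;
the class of `x^j` (for `j : ℤ`) corresponds to `xp n (j : ZMod n)`. -/
abbrev Rn (n : ℕ) : Type := AddMonoidAlgebra ℤ (ZMod n)

/-- The class of `x^w` in `ℤ[x]/(x^n - 1)`. -/
def xp (n : ℕ) (w : ZMod n) : Rn n := AddMonoidAlgebra.single w 1

/-- `e_v = x^v - 1`. -/
def eV (n : ℕ) (w : ZMod n) : Rn n := xp n w - 1

/-- `ε_v = d·e_v - e_{d·v}`. -/
def epsV (n : ℕ) (d : ℤ) (w : ZMod n) : Rn n := d • eV n w - eV n ((d : ZMod n) * w)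

/-- `𝒵_n`, the ℤ-span of the `e_v`, `1 ≤ v ≤ n-1`. -/
def ZSpan (n : ℕ) : Submodule ℤ (Rn n) :=
  Submodule.span ℤ {a : Rn n | ∃ v : ℤ, 1 ≤ v ∧ v ≤ (n : ℤ) - 1 ∧ a = eV n (v : ZMod n)}

/-- `ℰ_{n,d}`, the ℤ-span of the `ε_v`, `1 ≤ v ≤ n-1`. -/
def ESpan (n : ℕ) (d : ℤ) : Submodule ℤ (Rn n) :=
  Submodule.span ℤ {a : Rn n | ∃ v : ℤ, 1 ≤ v ∧ v ≤ (n : ℤ) - 1 ∧ a = epsV n d (v : ZMod n)}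

/-- `1 + x + ⋯ + x^{|d|-1}`. -/
def geomT (n : ℕ) (d : ℤ) : Rn n := ∑ i ∈ Finset.range d.natAbs, xp n (i : ZMod n)

/-- `f_v`: the Laplacian row polynomial of `DB(n,d)` (for `d ≥ 0`) resp. of
`Ktz(n,|d|)` (for `d < 0`). -/
def fV (n : ℕ) (d : ℤ) (v : ℤ) : Rn n :=
  if 0 ≤ d then d • xp n ((v : ZMod n)) - xp n (((d * v : ℤ) : ZMod n)) * geomT n d
  else d • xp n ((v : ZMod n)) + xp n (((d * (v + 1) : ℤ) : ZMod n)) * geomT n d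

/-- `F_{n,d}`, the ℤ-span of the `f_v`, `1 ≤ v ≤ n-1`. -/
def FSpan (n : ℕ) (d : ℤ) : Submodule ℤ (Rn n) :=
  Submodule.span ℤ {a : Rn n | ∃ v : ℤ, 1 ≤ v ∧ v ≤ (n : ℤ) - 1 ∧ a = fV n d v}

/-- The sand dune group `Σ(n,d) = 𝒵_n / ℰ_{n,d}`. -/
abbrev SandDune (n : ℕ) (d : ℤ) :=
  ZSpan n ⧸ Submodule.comap (ZSpan n).subtype (ESpan n d)

/-- The sandpile (critical) group `S(n,d) = 𝒵_n / F_{n,d}`. -/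
abbrev Sandpile (n : ℕ) (d : ℤ) :=
  ZSpan n ⧸ Submodule.comap (ZSpan n).subtype (FSpan n d)

/-- The `d`-sequence of `n`: `n_0 = n`, `n_{i+1} = n_i / gcd(n_i, |d|)`. -/
def dSeq (n : ℕ) (d : ℤ) : ℕ → ℕ
  | 0 => n
  | i + 1 => dSeq n d i / Nat.gcd (dSeq n d i) d.natAbs

/-- If `p` and `s` compose both ways to multiplication by `N`, which is bijective on `H`, then
`H` splits off `G` with complement the `N`-torsion of `G`. -/
theorem nonempty_addEquiv_ker_zsmul_prod {G H : Type*} [AddCommGroup G] [AddCommGroup H] (N : ℤ)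
    (p : G →+ H) (s : H →+ G) (hps : ∀ h, p (s h) = N • h) (hsp : ∀ g, s (p g) = N • g)
    (hN : Function.Bijective fun h : H => N • h) :
    Nonempty (G ≃+ ((zsmulAddGroupHom N : G →+ G).ker × H)) := by
  have hs : ∀ h, s h = 0 → h = 0 := fun h hh => hN.1 (by simp [← hps, hh])
  let F : (zsmulAddGroupHom N : G →+ G).ker × H →+ G := (AddSubgroup.subtype _).coprod s
  refine ⟨(AddEquiv.ofBijective F ⟨?_, ?_⟩).symm⟩
  · rw [injective_iff_map_eq_zero]
    rintro ⟨⟨a, ha⟩, h⟩ hah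
    replace ha : N • a = 0 := ha
    replace hah : a + s h = 0 := hah
    have hpa : p a = 0 := hs _ (by rw [hsp, ha])
    have hh : h = 0 := hN.1 (by simpa [hpa, hps] using congrArg p hah)
    subst hh
    simpa using hah
  · intro g
    obtain ⟨h, hh⟩ := hN.2 (p g)
    replace hh : N • h = p g := hh
    refine ⟨⟨⟨g - s h, ?_⟩, h⟩, sub_add_cancel g (s h)⟩
    change N • (g - s h) = 0
    rw [← hsp, map_sub, hps, hh, sub_self, map_zero]

/-- Modulo the image of `d - ψ`, the `j`-th power of `ψ` is multiplication by `d ^ j`. -/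
theorem zsmul_pow_sub_pow_apply_mem {M : Type*} [AddCommGroup M] {Z W : Submodule ℤ M}
    {ψ : Module.End ℤ M} (d : ℤ) (hZW : Z ≤ W) (hψ : ∀ z ∈ Z, ψ z ∈ Z) (j : ℕ) {z : M}
    (hz : z ∈ Z) :
    (ψ ^ j) z ∈ Z ∧ d ^ j • z - (ψ ^ j) z ∈ W.map (d • LinearMap.id - ψ) := by
  induction j with
  | zero => simpa using hz
  | succ j ih =>
    obtain ⟨h1, h2⟩ := ih
    refine ⟨by rw [pow_succ']; exact hψ _ h1, ?_⟩
    have h3 : d • (ψ ^ j) z - ψ ((ψ ^ j) z) ∈ W.map (d • LinearMap.id - ψ) :=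
      ⟨_, hZW h1, by simp⟩
    have h4 := add_mem (Submodule.smul_mem _ d h2) h3
    rw [pow_succ' ψ, Module.End.mul_apply, pow_succ', mul_smul]
    rwa [smul_sub, sub_add_sub_cancel] at h4

/-- The quotient `Z ⧸ (d - ψ) W` splits as its `d ^ k`-torsion plus the corresponding quotient
`Z' ⧸ (d - ψ') W'`, provided `ψ ^ k` factors through a surjection `π` intertwining `ψ` and `ψ'`,
and `ψ'` maps onto `Z'`. -/
theorem nonempty_quotient_addEquiv_ker_prod {M M' : Type*} [AddCommGroup M] [AddCommGroup M']
    (Z W : Submodule ℤ M) (Z' W' : Submodule ℤ M') (hZ' : Z'.FG) (hZW : Z ≤ W) (hZW' : Z' ≤ W')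
    (ψ : Module.End ℤ M) (ψ' : Module.End ℤ M') (π : M →ₗ[ℤ] M') (σ : M' →ₗ[ℤ] M)
    (d : ℤ) (k : ℕ)
    (hπZ : ∀ z ∈ Z, π z ∈ Z') (hσZ : ∀ z ∈ Z', σ z ∈ Z)
    (hπW : ∀ z ∈ W, π z ∈ W') (hσW : ∀ z ∈ W', σ z ∈ W)
    (hψZ : ∀ z ∈ Z, ψ z ∈ Z) (hψZ' : Z' ≤ Z'.map ψ')
    (hψZ'_mem : ∀ z ∈ Z', ψ' z ∈ Z')
    (hπ : Function.Surjective π) (hπψ : ∀ x, π (ψ x) = ψ' (π x))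
    (hσπ : ∀ x, σ (π x) = (ψ ^ k) x) :
    Nonempty ((Z ⧸ (W.map (d • LinearMap.id - ψ)).comap Z.subtype) ≃+
      ((zsmulAddGroupHom (d ^ k) : (Z ⧸ (W.map (d • LinearMap.id - ψ)).comap Z.subtype) →+
          (Z ⧸ (W.map (d • LinearMap.id - ψ)).comap Z.subtype)).ker ×
        (Z' ⧸ (W'.map (d • LinearMap.id - ψ')).comap Z'.subtype))) := by
  have hπpow : ∀ (j : ℕ) x, π ((ψ ^ j) x) = (ψ' ^ j) (π x) := by
    intro j
    induction j with
    | zero => simp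
    | succ j ih => intro x; rw [pow_succ', pow_succ']; simp [hπψ, ih]
  have hπσ : ∀ x, π (σ x) = (ψ' ^ k) x := by
    intro x
    obtain ⟨y, rfl⟩ := hπ x
    rw [hσπ, hπpow]
  have hσψ : ∀ x, σ (ψ' x) = ψ (σ x) := by
    intro x
    obtain ⟨y, rfl⟩ := hπ x
    rw [← hπψ, hσπ, hσπ, ← Module.End.mul_apply, ← Module.End.mul_apply, ← pow_succ, ← pow_succ']
  have hle : (W.map (d • LinearMap.id - ψ)).comap Z.subtype ≤
      ((W'.map (d • LinearMap.id - ψ')).comap Z'.subtype).comap (π.restrict hπZ) := by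
    rintro ⟨z, hz⟩ ⟨w, hw, hwz⟩
    refine ⟨π w, hπW w hw, ?_⟩
    replace hwz : d • w - ψ w = z := hwz
    change d • π w - ψ' (π w) = π z
    rw [← hwz, map_sub, map_zsmul, hπψ]
  have hle' : (W'.map (d • LinearMap.id - ψ')).comap Z'.subtype ≤
      ((W.map (d • LinearMap.id - ψ)).comap Z.subtype).comap (σ.restrict hσZ) := by
    rintro ⟨z, hz⟩ ⟨w, hw, hwz⟩
    refine ⟨σ w, hσW w hw, ?_⟩
    replace hwz : d • w - ψ' w = z := hwz
    change d • σ w - ψ (σ w) = σ z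
    rw [← hwz, map_sub, map_zsmul, hσψ]
  refine nonempty_addEquiv_ker_zsmul_prod (d ^ k)
    (Submodule.mapQ _ _ (π.restrict hπZ) hle).toAddMonoidHom
    (Submodule.mapQ _ _ (σ.restrict hσZ) hle').toAddMonoidHom ?_ ?_ ?_
  · intro h
    obtain ⟨⟨z, hz⟩, rfl⟩ := Submodule.Quotient.mk_surjective _ h
    refine Eq.symm ((Submodule.Quotient.eq _).2 ?_)
    change d ^ k • z - π (σ z) ∈ W'.map (d • LinearMap.id - ψ')
    rw [hπσ]
    exact (zsmul_pow_sub_pow_apply_mem d hZW' hψZ'_mem k hz).2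
  · intro g
    obtain ⟨⟨z, hz⟩, rfl⟩ := Submodule.Quotient.mk_surjective _ g
    refine Eq.symm ((Submodule.Quotient.eq _).2 ?_)
    change d ^ k • z - σ (π z) ∈ W.map (d • LinearMap.id - ψ)
    rw [hσπ]
    exact (zsmul_pow_sub_pow_apply_mem d hZW hψZ k hz).2
  · have hfin : Module.Finite ℤ Z' := Module.Finite.iff_fg.2 hZ'
    have hsurj : ∀ j : ℕ, Z' ≤ Z'.map (ψ' ^ j) := by
      intro j
      induction j with
      | zero => intro z hz; exact ⟨z, hz, by simp⟩
      | succ j ih =>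
        intro z hz
        obtain ⟨y, hy, rfl⟩ := ih hz
        obtain ⟨x, hx, rfl⟩ := hψZ' hy
        exact ⟨x, hx, by rw [pow_succ]; rfl⟩
    refine OrzechProperty.bijective_of_surjective_endomorphism
      (LinearMap.lsmul ℤ (Z' ⧸ (W'.map (d • LinearMap.id - ψ')).comap Z'.subtype) (d ^ k)) ?_
    intro g
    obtain ⟨⟨z, hz⟩, rfl⟩ := Submodule.Quotient.mk_surjective _ g
    obtain ⟨y, hy, rfl⟩ := hsurj k hz
    refine ⟨Submodule.Quotient.mk ⟨y, hy⟩, ?_⟩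
    refine (Submodule.Quotient.eq _).2 ?_
    exact (zsmul_pow_sub_pow_apply_mem d hZW' hψZ'_mem k hy).2

/-- The basis of `ℤ[x]/(x^n - 1)` formed by the powers of `x`. -/
def xpBasis (n : ℕ) : Module.Basis (ZMod n) ℤ (Rn n) :=
  Module.Basis.ofRepr (AddMonoidAlgebra.coeffLinearEquiv ℤ)

theorem xpBasis_apply (n : ℕ) (w : ZMod n) : xpBasis n w = xp n w := rfl

theorem xp_mul_xp (n : ℕ) (v w : ZMod n) : xp n v * xp n w = xp n (v + w) := by
  simp [xp, AddMonoidAlgebra.single_mul_single]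

theorem one_eq_xp_zero (n : ℕ) : (1 : Rn n) = xp n 0 := rfl

theorem exists_intCast_eq_of_ne_zero {n : ℕ} (hn : 1 ≤ n) {w : ZMod n} (hw : w ≠ 0) :
    ∃ v : ℤ, 1 ≤ v ∧ v ≤ (n : ℤ) - 1 ∧ w = (v : ZMod n) := by
  have : NeZero n := ⟨by omega⟩
  have h1 := ZMod.val_lt w
  have h2 : w.val ≠ 0 := fun h => hw ((ZMod.val_eq_zero w).1 h)
  exact ⟨w.val, by omega, by omega, by simp⟩

theorem eV_mem_ZSpan {n : ℕ} (hn : 1 ≤ n) (w : ZMod n) : eV n w ∈ ZSpan n := by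
  by_cases hw : w = 0
  · simp [hw, eV, one_eq_xp_zero]
  · obtain ⟨v, h1, h2, rfl⟩ := exists_intCast_eq_of_ne_zero hn hw
    exact Submodule.subset_span ⟨v, h1, h2, rfl⟩

theorem xp_sub_xp_mem_ZSpan {n : ℕ} (hn : 1 ≤ n) (v w : ZMod n) :
    xp n v - xp n w ∈ ZSpan n := by
  have := sub_mem (eV_mem_ZSpan hn v) (eV_mem_ZSpan hn w)
  simpa [eV] using this

theorem ZSpan_le_of_xp_sub_xp_mem {n : ℕ} {P : Submodule ℤ (Rn n)}
    (h : ∀ w, xp n w - xp n 0 ∈ P) : ZSpan n ≤ P := by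
  refine Submodule.span_le.2 ?_
  rintro _ ⟨v, -, -, rfl⟩
  exact h _

/-- The linear map `x^v ↦ ε x^(d v + c) (1 + x + ⋯ + x^(N - 1))`. -/
def affineShift (n : ℕ) (d ε c : ℤ) (N : ℕ) : Module.End ℤ (Rn n) :=
  (xpBasis n).constr ℤ fun v => ε • ∑ i ∈ range N, xp n (d * v + c + i)

theorem affineShift_xp (n : ℕ) (d ε c : ℤ) (N : ℕ) (v : ZMod n) :
    affineShift n d ε c N (xp n v) = ε • ∑ i ∈ range N, xp n (d * v + c + i) := by
  rw [affineShift, ← xpBasis_apply, Module.Basis.constr_basis]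

theorem affineShift_mem_ZSpan {n : ℕ} (hn : 1 ≤ n) (d ε c : ℤ) (N : ℕ) :
    ∀ z ∈ ZSpan n, affineShift n d ε c N z ∈ ZSpan n := by
  refine ZSpan_le_of_xp_sub_xp_mem (P := (ZSpan n).comap (affineShift n d ε c N)) fun w => ?_
  rw [Submodule.mem_comap, map_sub, affineShift_xp, affineShift_xp, ← smul_sub,
    ← sum_sub_distrib]
  exact Submodule.smul_mem _ _ (sum_mem fun i _ => xp_sub_xp_mem_ZSpan hn _ _)

theorem affineShift_pow_xp_congr (n : ℕ) (d ε c : ℤ) (N : ℕ) (j : ℕ) (v w : ZMod n)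
    (h : (d : ZMod n) ^ j * v = d ^ j * w) :
    (affineShift n d ε c N ^ j) (xp n v) = (affineShift n d ε c N ^ j) (xp n w) := by
  induction j generalizing v w with
  | zero => simpa using congrArg (xp n) (by simpa using h)
  | succ j ih =>
    rw [pow_succ, Module.End.mul_apply, Module.End.mul_apply, affineShift_xp, affineShift_xp,
      map_zsmul, map_zsmul, map_sum, map_sum]
    congr 1
    refine sum_congr rfl fun i _ => ih _ _ ?_
    linear_combination h

/-- For `d` and `N` invertible modulo `m`, the map `affineShift` is onto the augmentation ideal. -/
theorem ZSpan_le_map_affineShift {m : ℕ} (hm : 1 ≤ m) {d ε : ℤ} (c : ℤ) {N : ℕ}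
    (hd : IsUnit (d : ZMod m)) (hN : IsUnit (N : ZMod m)) (hε : ε * ε = 1) :
    ZSpan m ≤ (ZSpan m).map (affineShift m d ε c N) := by
  set P := (ZSpan m).map (affineShift m d ε c N) with hP
  have : NeZero m := ⟨by omega⟩
  have h1 : ∀ a b : ZMod m,
      ∑ i ∈ range N, xp m (a + i) - ∑ i ∈ range N, xp m (b + i) ∈ P := by
    intro a b
    obtain ⟨u, hu⟩ := hd.exists_right_inv
    refine ⟨ε • (xp m (u * (a - c)) - xp m (u * (b - c))),
      Submodule.smul_mem _ _ (xp_sub_xp_mem_ZSpan hm _ _), ?_⟩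
    rw [map_zsmul, map_sub, affineShift_xp, affineShift_xp, ← smul_sub, smul_smul, hε, one_smul,
      ← mul_assoc, ← mul_assoc, hu, one_mul, one_mul, sub_add_cancel, sub_add_cancel]
  have h2 : ∀ a : ZMod m, xp m (a + N) - xp m a ∈ P := by
    intro a
    have h := h1 (a + 1) a
    have e : ∑ i ∈ range N, xp m (a + 1 + i) = ∑ i ∈ range N, xp m (a + (i + 1 : ℕ)) :=
      sum_congr rfl fun i _ => by push_cast; congr 1; ring
    rw [e, ← sum_sub_distrib, sum_range_sub (fun i : ℕ => xp m (a + i))] at h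
    simpa using h
  have h3 : ∀ j : ℕ, xp m (N * j) - xp m 0 ∈ P := by
    intro j
    induction j with
    | zero => simp
    | succ j ih =>
      have := add_mem (h2 (N * j)) ih
      rw [sub_add_sub_cancel] at this
      convert this using 3
      push_cast
      ring
  refine ZSpan_le_of_xp_sub_xp_mem fun w => ?_
  obtain ⟨u, hu⟩ := hN.exists_right_inv
  have := h3 (u * w).val
  rwa [ZMod.natCast_zmod_val, ← mul_assoc, hu, one_mul] at this

theorem ZSpan_fg (n : ℕ) : (ZSpan n).FG := by
  refine Submodule.fg_span (Set.Finite.subset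
    ((Set.finite_Icc (1 : ℤ) (n - 1)).image fun v : ℤ => eV n (v : ZMod n)) ?_)
  rintro _ ⟨v, h1, h2, rfl⟩
  exact ⟨v, ⟨h1, h2⟩, rfl⟩

/-- The linear map induced by a map of exponents. -/
def xpMap {n m : ℕ} (f : ZMod n → ZMod m) : Rn n →ₗ[ℤ] Rn m :=
  (xpBasis n).constr ℤ fun v => xp m (f v)

theorem xpMap_xp {n m : ℕ} (f : ZMod n → ZMod m) (v : ZMod n) :
    xpMap f (xp n v) = xp m (f v) := by
  rw [xpMap, ← xpBasis_apply, Module.Basis.constr_basis]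

theorem xpMap_mem_ZSpan {n m : ℕ} (hm : 1 ≤ m) (f : ZMod n → ZMod m) :
    ∀ z ∈ ZSpan n, xpMap f z ∈ ZSpan m := by
  refine ZSpan_le_of_xp_sub_xp_mem (P := (ZSpan m).comap (xpMap f)) fun w => ?_
  rw [Submodule.mem_comap, map_sub, xpMap_xp, xpMap_xp]
  exact xp_sub_xp_mem_ZSpan hm _ _

/-- The splitting for the quotients of `𝒵_n` and `𝒵_m` by images of `d - affineShift`. -/
theorem nonempty_quotient_affineShift_addEquiv {n m : ℕ} (hn : 1 ≤ n) (hm : 1 ≤ m) (hmn : m ∣ n)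
    {d ε : ℤ} (c : ℤ) {N k : ℕ} (hnd : (n : ℤ) ∣ d ^ k * m)
    (hd : IsUnit (d : ZMod m)) (hN : IsUnit (N : ZMod m)) (hε : ε * ε = 1)
    (W : Submodule ℤ (Rn n)) (W' : Submodule ℤ (Rn m)) (hZW : ZSpan n ≤ W) (hZW' : ZSpan m ≤ W')
    (hW : ∀ f : ZMod n → ZMod m, ∀ z ∈ W, xpMap f z ∈ W')
    (hW' : ∀ f : ZMod m → ZMod n, ∀ z ∈ W', xpMap f z ∈ W)
    (hψW : ∀ z ∈ W, affineShift n d ε c N z ∈ W) :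
    Nonempty ((ZSpan n ⧸ (W.map (d • LinearMap.id - affineShift n d ε c N)).comap
        (ZSpan n).subtype) ≃+
      ((zsmulAddGroupHom (d ^ k) :
          (ZSpan n ⧸ (W.map (d • LinearMap.id - affineShift n d ε c N)).comap
            (ZSpan n).subtype) →+
          (ZSpan n ⧸ (W.map (d • LinearMap.id - affineShift n d ε c N)).comap
            (ZSpan n).subtype)).ker ×
        (ZSpan m ⧸ (W'.map (d • LinearMap.id - affineShift m d ε c N)).comap
          (ZSpan m).subtype))) := by
  have : NeZero n := ⟨by omega⟩
  have : NeZero m := ⟨by omega⟩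
  set ψ := affineShift n d ε c N with hψ
  have hpow : ∀ P : Submodule ℤ (Rn n), (∀ z ∈ P, ψ z ∈ P) → ∀ j : ℕ, ∀ z ∈ P, (ψ ^ j) z ∈ P := by
    intro P hP j
    induction j with
    | zero => simp
    | succ j ih => intro z hz; rw [pow_succ']; exact hP _ (ih z hz)
  have hψZ : ∀ z ∈ ZSpan n, ψ z ∈ ZSpan n := affineShift_mem_ZSpan hn d ε c N
  let r : ZMod n → ZMod m := ZMod.castHom hmn (ZMod m)
  let s : ZMod m → ZMod n := fun w => (w.val : ZMod n)
  have hrs : ∀ w, r (s w) = w := fun w => by simp [r, s]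
  refine nonempty_quotient_addEquiv_ker_prod (ZSpan n) W (ZSpan m) W' (ZSpan_fg m) hZW hZW'
    ψ (affineShift m d ε c N) (xpMap r) ((ψ ^ k : Module.End ℤ (Rn n)) ∘ₗ xpMap s) d k
    (xpMap_mem_ZSpan hm r) (fun z hz => hpow _ hψZ k _ (xpMap_mem_ZSpan hn s z hz))
    (hW r) (fun z hz => hpow _ hψW k _ (hW' s z hz)) hψZ
    (ZSpan_le_map_affineShift hm c hd hN hε) (affineShift_mem_ZSpan hm d ε c N) ?_ ?_ ?_
  · have h : xpMap r ∘ₗ xpMap s = LinearMap.id := by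
      refine (xpBasis m).ext fun w => ?_
      simp [xpBasis_apply, xpMap_xp, hrs]
    exact fun x => ⟨xpMap s x, LinearMap.congr_fun h x⟩
  · have h : xpMap r ∘ₗ ψ = affineShift m d ε c N ∘ₗ xpMap r := by
      refine (xpBasis n).ext fun w => ?_
      simp only [LinearMap.comp_apply, xpBasis_apply, xpMap_xp, hψ, affineShift_xp, map_zsmul,
        map_sum, r, map_add, map_mul, map_intCast, map_natCast]
    exact LinearMap.congr_fun h
  · have h : ((ψ ^ k : Module.End ℤ (Rn n)) ∘ₗ xpMap s) ∘ₗ xpMap r = ψ ^ k := by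
      refine (xpBasis n).ext fun w => ?_
      simp only [xpBasis_apply, LinearMap.comp_apply, xpMap_xp]
      refine affineShift_pow_xp_congr n d ε c N k _ _ ?_
      have h0 : r (s (r w) - w) = 0 := by
        have := hrs (r w)
        simp only [r] at this ⊢
        rw [map_sub, this, sub_self]
      have h1 : ((s (r w) - w).val : ZMod m) = 0 := by
        simpa [r] using h0
      obtain ⟨t, ht⟩ := (ZMod.natCast_eq_zero_iff _ _).1 h1
      have h2 : s (r w) - w = (m * t : ℕ) := by
        rw [← ht, ZMod.natCast_zmod_val]
      have h3 : (d : ZMod n) ^ k * m = 0 := by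
        have := (ZMod.intCast_zmod_eq_zero_iff_dvd _ n).2 hnd
        simpa using this
      rw [← sub_eq_zero, ← mul_sub, h2]
      push_cast
      rw [← mul_assoc, h3, zero_mul]
    exact LinearMap.congr_fun h

theorem ESpan_eq_map {n : ℕ} (d : ℤ) :
    ESpan n d = (ZSpan n).map (d • LinearMap.id - affineShift n d 1 0 1) := by
  rw [ESpan, ZSpan, Submodule.map_span]
  congr 1
  ext a
  simp only [Set.mem_ofPred_eq, Set.mem_image]
  have key : ∀ w : ZMod n,
      (d • LinearMap.id - affineShift n d 1 0 1 : Module.End ℤ (Rn n)) (eV n w) = epsV n d w := by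
    intro w
    simp [eV, epsV, one_eq_xp_zero, affineShift_xp]
  constructor
  · rintro ⟨v, h1, h2, rfl⟩
    exact ⟨_, ⟨v, h1, h2, rfl⟩, key _⟩
  · rintro ⟨_, ⟨v, h1, h2, rfl⟩, rfl⟩
    exact ⟨v, h1, h2, key _⟩

/-- The sign occurring in the Laplacian row polynomials. -/
def fSign (d : ℤ) : ℤ := if 0 ≤ d then 1 else -1

/-- The constant shift occurring in the Laplacian row polynomials. -/
def fShift (d : ℤ) : ℤ := if 0 ≤ d then 0 else d

theorem fV_eq (n : ℕ) (d v : ℤ) :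
    fV n d v = (d • LinearMap.id - affineShift n d (fSign d) (fShift d) d.natAbs :
      Module.End ℤ (Rn n)) (xp n v) := by
  simp only [LinearMap.sub_apply, LinearMap.smul_apply, LinearMap.id_apply, affineShift_xp]
  unfold fV fSign fShift geomT
  split_ifs <;> simp [mul_sum, xp_mul_xp, mul_add, sub_eq_add_neg]

theorem sum_range_sum_range_mul_add {M : Type*} [AddCommMonoid M] (f : ℕ → M) (a b : ℕ) :
    ∑ j ∈ range a, ∑ i ∈ range b, f (b * j + i) = ∑ t ∈ range (b * a), f t := by
  induction a with
  | zero => simp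
  | succ a ih => rw [sum_range_succ, ih, mul_add_one, sum_range_add]

theorem sum_zmod_eq_sum_range {M : Type*} [AddCommMonoid M] (n : ℕ) [NeZero n] (f : ZMod n → M) :
    ∑ w, f w = ∑ r ∈ range n, f r :=
  sum_nbij' ZMod.val (fun r => (r : ZMod n)) (fun w _ => mem_range.2 (ZMod.val_lt w))
    (fun _ _ => mem_univ _) (fun w _ => ZMod.natCast_zmod_val w)
    (fun _ hr => ZMod.val_cast_of_lt (mem_range.1 hr)) (fun w _ => by rw [ZMod.natCast_zmod_val])

theorem sum_sum_mul_add {M : Type*} [AddCommMonoid M] (n N : ℕ) [NeZero n] (f : ZMod n → M) :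
    ∑ w, ∑ i ∈ range N, f (N * w + i) = N • ∑ w, f w := by
  have h1 := sum_range_sum_range_mul_add (fun t : ℕ => f (t : ZMod n)) n N
  have h2 := sum_range_sum_range_mul_add (fun t : ℕ => f (t : ZMod n)) N n
  rw [mul_comm n N, ← h1] at h2
  simpa [sum_zmod_eq_sum_range] using h2.symm

/-- Every residue is hit equally often by the arcs of the graph. -/
theorem sum_affineShift_xp (n : ℕ) [NeZero n] (d : ℤ) :
    ∑ w : ZMod n, (d • LinearMap.id - affineShift n d (fSign d) (fShift d) d.natAbs :
      Module.End ℤ (Rn n)) (xp n w) = 0 := by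
  have h := sum_sum_mul_add n d.natAbs (xp n)
  simp only [LinearMap.sub_apply, LinearMap.smul_apply, LinearMap.id_apply, affineShift_xp,
    sum_sub_distrib, ← smul_sum]
  unfold fSign fShift
  split_ifs with hd
  · obtain ⟨N, rfl⟩ := Int.eq_ofNat_of_zero_le hd
    simp at h ⊢
    simp [h]
  · obtain ⟨N, rfl⟩ := Int.exists_eq_neg_ofNat (not_le.1 hd).le
    have e : ∑ w : ZMod n, ∑ i ∈ range N, xp n (-N * w + -N + i) =
        ∑ w : ZMod n, ∑ i ∈ range N, xp n (N * w + i) := by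
      refine Fintype.sum_equiv (Equiv.subLeft (-1 : ZMod n)) _ _ fun w => ?_
      refine sum_congr rfl fun i _ => congrArg (xp n) ?_
      rw [Equiv.subLeft_apply]
      ring
    simp at h e ⊢
    simp [h, e]

theorem FSpan_eq_map {n : ℕ} (hn : 1 ≤ n) (d : ℤ) :
    FSpan n d = (⊤ : Submodule ℤ (Rn n)).map
      (d • LinearMap.id - affineShift n d (fSign d) (fShift d) d.natAbs) := by
  have : NeZero n := ⟨by omega⟩
  set L : Module.End ℤ (Rn n) :=
    d • LinearMap.id - affineShift n d (fSign d) (fShift d) d.natAbs with hL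
  have hne : ∀ w : ZMod n, w ≠ 0 → L (xp n w) ∈ FSpan n d := by
    intro w hw
    obtain ⟨v, h1, h2, rfl⟩ := exists_intCast_eq_of_ne_zero hn hw
    exact Submodule.subset_span ⟨v, h1, h2, (fV_eq n d v).symm⟩
  apply le_antisymm
  · refine Submodule.span_le.2 ?_
    rintro _ ⟨v, -, -, rfl⟩
    exact ⟨_, trivial, (fV_eq n d v).symm⟩
  · rw [← (xpBasis n).span_eq, Submodule.map_span, Submodule.span_le]
    rintro _ ⟨_, ⟨w, rfl⟩, rfl⟩
    rw [xpBasis_apply]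
    by_cases hw : w = 0
    · have h := sum_affineShift_xp n d
      rw [← hL, ← add_sum_erase univ _ (mem_univ (0 : ZMod n)), add_eq_zero_iff_eq_neg] at h
      rw [hw, h]
      exact neg_mem (sum_mem fun i hi => hne i (ne_of_mem_erase hi))
    · exact hne w hw

theorem isUnit_intCast_of_natAbs {R : Type*} [Ring R] {d : ℤ} (h : IsUnit (d.natAbs : R)) :
    IsUnit (d : R) := by
  obtain ⟨N, rfl | rfl⟩ := d.eq_nat_or_neg <;> simpa using h

/-- Each term of the `d`-sequence divides `n`, with a quotient dividing a power of `d`. -/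
theorem dSeq_spec (n : ℕ) (d : ℤ) (hn : 1 ≤ n) (k : ℕ) :
    1 ≤ dSeq n d k ∧ dSeq n d k ∣ n ∧ (n : ℤ) ∣ d ^ k * dSeq n d k := by
  induction k with
  | zero => simpa [dSeq] using hn
  | succ k ih =>
    obtain ⟨h1, h2, h3⟩ := ih
    have hg := Nat.gcd_dvd_left (dSeq n d k) d.natAbs
    have hg' : (Nat.gcd (dSeq n d k) d.natAbs : ℤ) ∣ d :=
      Int.natCast_dvd.2 (Nat.gcd_dvd_right _ _)
    have hmul := Nat.div_mul_cancel hg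
    rw [dSeq]
    refine ⟨Nat.div_pos (Nat.le_of_dvd h1 hg) (Nat.gcd_pos_of_pos_left _ h1),
      (Nat.div_dvd_of_dvd hg).trans h2, h3.trans ?_⟩
    obtain ⟨t, ht⟩ := hg'
    refine ⟨t, ?_⟩
    set g := Nat.gcd (dSeq n d k) d.natAbs
    set q := dSeq n d k / g
    have hmul' : (dSeq n d k : ℤ) = q * g := by exact_mod_cast hmul.symm
    rw [hmul', pow_succ]
    nth_rewrite 2 [ht]
    ring

/-- with `d`-sequence `n = n_0 > ⋯ > n_k = n_{k+1}`, `m = n_k`, and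
`Σ_0(n,d)`, `S_0(n,d)` the kernels of `g ↦ d^k·g` on `Σ(n,d)` and `S(n,d)`, one
has `Σ(n,d) ≅ Σ_0(n,d) ⊕ Σ(m,d)` and `S(n,d) ≅ S_0(n,d) ⊕ S(m,d)`. -/
theorem stmt10 (n : ℕ) (d : ℤ) (hn : 1 ≤ n) (hd : 2 ≤ |d|) (k : ℕ)
    (hk1 : Nat.gcd (dSeq n d k) d.natAbs = 1)
    (hk2 : ∀ i < k, Nat.gcd (dSeq n d i) d.natAbs ≠ 1) :
    Nonempty (SandDune n d ≃+
      ((zsmulAddGroupHom (d ^ k) : SandDune n d →+ SandDune n d).ker ×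
        SandDune (dSeq n d k) d)) ∧
    Nonempty (Sandpile n d ≃+
      ((zsmulAddGroupHom (d ^ k) : Sandpile n d →+ Sandpile n d).ker ×
        Sandpile (dSeq n d k) d)) := by
  obtain ⟨hm, hmn, hnd⟩ := dSeq_spec n d hn k
  have hN : IsUnit ((d.natAbs : ℕ) : ZMod (dSeq n d k)) :=
    (ZMod.isUnit_iff_coprime _ _).2 (Nat.Coprime.symm hk1)
  have hdu : IsUnit (d : ZMod (dSeq n d k)) := isUnit_intCast_of_natAbs hN
  constructor
  · unfold SandDune
    rw [ESpan_eq_map, ESpan_eq_map]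
    exact nonempty_quotient_affineShift_addEquiv hn hm hmn 0 hnd hdu (by simp) (by norm_num)
      (ZSpan n) (ZSpan _) le_rfl le_rfl (xpMap_mem_ZSpan hm) (xpMap_mem_ZSpan hn)
      (affineShift_mem_ZSpan hn d 1 0 1)
  · unfold Sandpile
    rw [FSpan_eq_map hn, FSpan_eq_map hm]
    exact nonempty_quotient_affineShift_addEquiv hn hm hmn _ hnd hdu hN
      (by unfold fSign; split_ifs <;> norm_num) ⊤ ⊤ le_top le_top
      (fun _ _ _ => trivial) (fun _ _ _ => trivial) (fun _ _ => trivial)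
end
end

section
/- Let m ≥ 2 and d ≥ 2 be integers with gcd(m, d) = 1, let p be a prime dividing m, let s = ν_p(m), and let M_p = m/p^s. For w ∈ ℤ/m let o(w) denote the least integer e ≥ 1 with d^e·w = w in ℤ/m (the size of the orbit of w under multiplication by d). If p ≠ 2 or d ≡ 1 (mod 4), then ν_p(d^{o(M_p)} − 1) − ν_p(d^{o(p^t·M_p)} − 1) ≤ t for every 1 ≤ t ≤ s − 1. If p = 2 and d ≡ 3 (mod 4), then the same inequality holds for every 1 ≤ t ≤ s − 2. -/
/-- Lifting the exponent for `x ^ p ^ t - 1`, with the usual extra hypothesis at `p = 2`. -/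
theorem padicValNat_pow_prime_pow_sub_one {p x : ℕ} (hp : p.Prime) (hx : 1 < x)
    (hpx : p ∣ x - 1) (h4 : p = 2 → 4 ∣ x - 1) (t : ℕ) :
    padicValNat p (x ^ p ^ t - 1) = padicValNat p (x - 1) + t := by
  have := Fact.mk hp
  have hnx : ¬ p ∣ x := fun h => hp.one_lt.ne' (Nat.dvd_one.mp (by
    simpa [Nat.sub_sub_self hx.le] using Nat.dvd_sub h hpx))
  rcases hp.eq_two_or_odd' with rfl | hodd
  · rcases Nat.eq_zero_or_pos t with rfl | ht
    · simp
    have h := padicValNat.pow_two_sub_pow (x := x) (y := 1) hx (by simpa using hpx) hnx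
      (n := 2 ^ t) (by positivity) (by simp [Nat.even_pow, ht.ne'])
    have h1 : padicValNat 2 (x + 1) = 1 := by
      obtain ⟨c, hc⟩ := h4 rfl
      have hxc : x + 1 = 2 * (2 * c + 1) := by omega
      rw [hxc, padicValNat.mul (by norm_num) (by omega), padicValNat.self (by norm_num),
        padicValNat.eq_zero_of_not_dvd (by omega)]
    rw [one_pow, h1, padicValNat.prime_pow] at h
    omega
  · have h := padicValNat.pow_sub_pow (x := x) (y := 1) hodd hx (by simpa using hpx) hnx
      (n := p ^ t) (pow_ne_zero _ hp.ne_zero)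
    rwa [one_pow, padicValNat.prime_pow] at h

/-- If `o` is the least positive exponent with `a ^ o * w = w`, it divides every such exponent. -/
theorem dvd_of_pow_mul_eq_self_of_least {M : Type*} [Monoid M] {a w : M} {o e : ℕ}
    (ho : 0 < o) (how : a ^ o * w = w) (hmin : ∀ e : ℕ, 0 < e → a ^ e * w = w → o ≤ e)
    (he : a ^ e * w = w) : o ∣ e := by
  have hq : ∀ q : ℕ, a ^ (o * q) * w = w := by
    intro q
    induction q with
    | zero => simp
    | succ q ih => rw [Nat.mul_succ, pow_add, mul_assoc, how, ih]
  have hr : a ^ (e % o) * w = w := by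
    conv_lhs => rw [← hq (e / o)]
    rw [← mul_assoc, ← pow_add, Nat.mod_add_div, he]
  by_contra h
  have h0 : 0 < e % o := Nat.pos_of_ne_zero fun h' => h (Nat.dvd_of_mod_eq_zero h')
  exact (hmin _ h0 hr).not_gt (Nat.mod_lt _ ho)

theorem ZMod.natCast_pow_mul_eq_self_iff {m d w e : ℕ} (hd : 0 < d) :
    (d : ZMod m) ^ e * (w : ZMod m) = w ↔ m ∣ (d ^ e - 1) * w := by
  rw [← ZMod.natCast_eq_zero_iff, Nat.cast_mul, Nat.cast_sub (Nat.one_le_pow _ _ hd), sub_mul,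
    Nat.cast_pow, Nat.cast_one, one_mul, sub_eq_zero]

theorem padicValNat_orbit_sub_le {m d p t : ℕ} (hm : m ≠ 0) (hd : 2 ≤ d) (hp : p.Prime)
    (ht : t < padicValNat p m)
    (h4 : p = 2 → d % 4 = 1 ∨ t + 2 ≤ padicValNat p m)
    (o : ZMod m → ℕ)
    (ho : ∀ w : ZMod m, 0 < o w ∧ (d : ZMod m) ^ (o w) * w = w ∧
      ∀ e : ℕ, 0 < e → (d : ZMod m) ^ e * w = w → o w ≤ e) :
    padicValNat p (d ^ o ((m / p ^ padicValNat p m : ℕ) : ZMod m) - 1) -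
      padicValNat p (d ^ o ((p ^ t * (m / p ^ padicValNat p m) : ℕ) : ZMod m) - 1) ≤ t := by
  have := Fact.mk hp
  generalize hs : padicValNat p m = s at *
  have hms : m = p ^ s * (m / p ^ s) := (Nat.mul_div_cancel' (hs ▸ pow_padicValNat_dvd)).symm
  generalize m / p ^ s = M at *
  have hM : 0 < M := Nat.pos_of_ne_zero (by rintro rfl; simp at hms; exact hm hms)
  obtain ⟨hE0, hE, -⟩ := ho ((p ^ t * M : ℕ) : ZMod m)
  obtain ⟨hF0, hF, hmin⟩ := ho (M : ZMod m)
  generalize o ((p ^ t * M : ℕ) : ZMod m) = E at *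
  generalize o (M : ZMod m) = F at *
  rw [ZMod.natCast_pow_mul_eq_self_iff (by omega)] at hE
  have hx : 1 < d ^ E := Nat.one_lt_pow hE0.ne' (by omega)
  have hpt : 0 < p ^ t := pow_pos hp.pos t
  have hk : p ^ (s - t) ∣ d ^ E - 1 := by
    have hst : p ^ s = p ^ (s - t) * p ^ t := by rw [← pow_add, Nat.sub_add_cancel ht.le]
    refine Nat.dvd_of_mul_dvd_mul_right (Nat.mul_pos hpt hM) ?_
    rwa [← mul_assoc, ← hst, ← hms]
  have hlte : padicValNat p (d ^ (E * p ^ t) - 1) = padicValNat p (d ^ E - 1) + t := by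
    rw [pow_mul]
    refine padicValNat_pow_prime_pow_sub_one hp hx
      ((dvd_pow_self p (by omega)).trans hk) (fun h2 => ?_) t
    rcases h4 h2 with h | h
    · exact (Nat.modEq_iff_dvd' hx.le).mp (by simpa using ((show d ≡ 1 [MOD 4] from h).pow E).symm)
    · subst h2
      exact (pow_dvd_pow 2 (show 2 ≤ s - t by omega)).trans hk
  have hx' : d ^ (E * p ^ t) - 1 ≠ 0 :=
    (Nat.sub_pos_of_lt (Nat.one_lt_pow (Nat.mul_pos hE0 hpt).ne' (by omega))).ne'
  have hdvd : F ∣ E * p ^ t := by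
    refine dvd_of_pow_mul_eq_self_of_least hF0 hF hmin ?_
    rw [ZMod.natCast_pow_mul_eq_self_iff (by omega)]
    conv_lhs => rw [hms]
    refine Nat.mul_dvd_mul_right ((padicValNat_dvd_iff_le hx').mpr ?_) M
    have := (padicValNat_dvd_iff_le (p := p) (Nat.sub_pos_of_lt hx).ne').mp hk
    omega
  have hle : padicValNat p (d ^ F - 1) ≤ padicValNat p (d ^ (E * p ^ t) - 1) :=
    (padicValNat_dvd_iff_le hx').mp
      (pow_padicValNat_dvd.trans (Nat.pow_sub_one_dvd_pow_sub_one d hdvd))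
  omega


/-- let `m ≥ 2`, `d ≥ 2` with `gcd(m,d) = 1`, `p` a prime dividing
`m`, `s = ν_p(m)`, `M_p = m/p^s`, and for `w : ZMod m` let `o w` be the least
`e ≥ 1` with `d^e·w = w`. If `p ≠ 2` or `d ≡ 1 (mod 4)`, then
`ν_p(d^{o(M_p)} − 1) − ν_p(d^{o(p^t·M_p)} − 1) ≤ t` for `1 ≤ t ≤ s − 1`; if
`p = 2` and `d ≡ 3 (mod 4)`, the same holds for `1 ≤ t ≤ s − 2`. -/
theorem stmt14 (m d : ℕ) (hm : 2 ≤ m) (hd : 2 ≤ d) (hcop : Nat.Coprime m d)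
    (p : ℕ) (hp : p.Prime) (hpm : p ∣ m)
    (o : ZMod m → ℕ)
    (ho : ∀ w : ZMod m, 0 < o w ∧ (d : ZMod m) ^ (o w) * w = w ∧
      ∀ e : ℕ, 0 < e → (d : ZMod m) ^ e * w = w → o w ≤ e) :
    ((p ≠ 2 ∨ d % 4 = 1) →
      ∀ t : ℕ, 1 ≤ t → t ≤ padicValNat p m - 1 →
        padicValNat p (d ^ o (((m / p ^ padicValNat p m : ℕ) : ZMod m)) - 1) -
          padicValNat p
            (d ^ o (((p ^ t * (m / p ^ padicValNat p m) : ℕ) : ZMod m)) - 1) ≤ t) ∧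
    (p = 2 → d % 4 = 3 →
      ∀ t : ℕ, 1 ≤ t → t ≤ padicValNat p m - 2 →
        padicValNat p (d ^ o (((m / p ^ padicValNat p m : ℕ) : ZMod m)) - 1) -
          padicValNat p
            (d ^ o (((p ^ t * (m / p ^ padicValNat p m : ℕ) : ℕ) : ZMod m)) - 1) ≤ t) := by
  constructor
  · intro h t ht1 hts
    exact padicValNat_orbit_sub_le (by omega) hd hp (by omega)
      (fun h2 => Or.inl (h.resolve_left (not_not.mpr h2))) o ho
  · intro _ _ t ht1 hts
    exact padicValNat_orbit_sub_le (by omega) hd hp (by omega) (fun _ => Or.inr (by omega)) o ho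
end
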